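/- arXiv:math/0602407 — 2 statements merged into one kernel-verified Lean document; each statement's English description precedes it below -/
import Mathlib

section
/- Let (E_n)_{n∈ℕ} be a sequence of real Banach spaces together with injective continuous linear maps i_n : E_n → E_{n+1} such that each i_n is a compact operator. Then there exist real Banach spaces F_n together with injective continuous linear maps α_n : E_n → F_n and β_n : F_n → E_{n+1} satisfying β_n ∘ α_n = i_n for each n, and such that for each n the composite map α_{n+1} ∘ β_n : F_n → F_{n+1} sends every closed ball of F_n (with respect to the norm of F_n) to a compact subset of F_{n+1}. -/
open Topology

universe u

/-- The data interpolating a compact direct sequence of Banach spaces, as in Lemma 3.1: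
Banach spaces `F n` with injective continuous linear maps `α n : E n → F n` and
`β n : F n → E (n+1)` factoring the inclusion `i n : E n → E (n+1)`, such that each
composite `α (n+1) ∘ β n : F n → F (n+1)` maps closed balls of `F n` to compact subsets
of `F (n+1)`. -/
structure SilvaInterpolation (E : ℕ → Type u) [∀ n, NormedAddCommGroup (E n)]
    [∀ n, NormedSpace ℝ (E n)] (i : ∀ n, E n →L[ℝ] E (n + 1)) where
  F : ℕ → Type u
  [instNorm : ∀ n, NormedAddCommGroup (F n)]
  [instSpace : ∀ n, NormedSpace ℝ (F n)]
  [instComplete : ∀ n, CompleteSpace (F n)]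
  α : ∀ n, E n →L[ℝ] F n
  β : ∀ n, F n →L[ℝ] E (n + 1)
  α_inj : ∀ n, Function.Injective (α n)
  β_inj : ∀ n, Function.Injective (β n)
  factor : ∀ n (x : E n), β n (α n x) = i n x
  ball_compact : ∀ n (x : F n) (r : ℝ), 0 < r →
    IsCompact ((fun y => α (n + 1) (β n y)) '' Metric.closedBall x r)

open scoped Pointwise

/-- In the span of a balanced convex set, every vector lies in a positive multiple of the set. -/
theorem exists_pos_mem_smul_of_mem_span {V : Type*} [AddCommGroup V] [Module ℝ V] {K : Set V}
    (hb : Balanced ℝ K) (hc : Convex ℝ K) (h0 : (0 : V) ∈ K) {x : V}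
    (hx : x ∈ Submodule.span ℝ K) : ∃ r : ℝ, 0 < r ∧ x ∈ r • K := by
  induction hx using Submodule.span_induction with
  | mem x hx => exact ⟨1, one_pos, by simpa using hx⟩
  | zero => exact ⟨1, one_pos, by simpa using h0⟩
  | add x y _ _ ihx ihy =>
    obtain ⟨r, hr, hxr⟩ := ihx
    obtain ⟨s, hs, hys⟩ := ihy
    refine ⟨r + s, add_pos hr hs, ?_⟩
    rw [hc.add_smul hr.le hs.le]
    exact Set.add_mem_add hxr hys
  | smul a x _ ih =>
    obtain ⟨r, hr, k, hk, rfl⟩ := ih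
    refine ⟨(|a| + 1) * r, by positivity, (a / (|a| + 1)) • k, hb.smul_mem ?_ hk, ?_⟩
    · rw [Real.norm_eq_abs, abs_div, abs_of_pos (by positivity : 0 < |a| + 1)]
      exact div_le_one_of_le₀ (by linarith) (by positivity)
    · simp only [smul_smul]
      congr 1
      field_simp

/-- A closed bounded balanced convex set containing `0` is the image of the closed unit ball
of some normed space under an injective linear map. -/
theorem exists_normedSpace_closedBall_eq {V : Type u} [NormedAddCommGroup V] [NormedSpace ℝ V]
    {K : Set V} (hb : Balanced ℝ K) (hc : Convex ℝ K) (h0 : (0 : V) ∈ K) (hcl : IsClosed K)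
    (hbd : Bornology.IsBounded K) :
    ∃ (F : Type u) (_ : NormedAddCommGroup F) (_ : NormedSpace ℝ F) (β : F →ₗ[ℝ] V),
      Function.Injective β ∧ K ⊆ Set.range β ∧ ∀ x, ‖x‖ ≤ 1 ↔ β x ∈ K := by
  suffices key : ∀ {S : Type u} [AddCommGroup S] [Module ℝ S] (ι : S →ₗ[ℝ] V),
      Function.Injective ι → K ⊆ Set.range ι → (∀ x, ∃ r : ℝ, 0 < r ∧ ι x ∈ r • K) →
      ∃ (F : Type u) (_ : NormedAddCommGroup F) (_ : NormedSpace ℝ F) (β : F →ₗ[ℝ] V),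
        Function.Injective β ∧ K ⊆ Set.range β ∧ ∀ x, ‖x‖ ≤ 1 ↔ β x ∈ K from
    key (Submodule.span ℝ K).subtype (Submodule.span ℝ K).injective_subtype
      (fun x hx => ⟨⟨x, Submodule.subset_span hx⟩, rfl⟩)
      (fun x => exists_pos_mem_smul_of_mem_span hb hc h0 x.2)
  intro S _ _ ι hι hK habs
  set B : Set S := ι ⁻¹' K with hB
  have hBc : Convex ℝ B := hc.linear_preimage ι
  have hBb : Balanced ℝ B := fun a ha => by
    rintro _ ⟨x, hx, rfl⟩
    simpa [hB] using hb.smul_mem ha hx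
  have hBa : Absorbent ℝ B := fun x => by
    obtain ⟨r, hr, k, hk, hkx⟩ := habs x
    refine Absorbs.of_norm ⟨r, fun c hc => Set.singleton_subset_iff.2 ?_⟩
    have hc0 : 0 < ‖c‖ := hr.trans_le hc
    rw [Set.mem_smul_set_iff_inv_smul_mem₀ (norm_pos_iff.1 hc0), hB, Set.mem_preimage, map_smul,
      ← hkx, smul_smul]
    refine hb.smul_mem ?_ hk
    rw [norm_mul, norm_inv, Real.norm_of_nonneg hr.le]
    exact (inv_mul_le_iff₀ hc0).2 (by linarith)
  have hlt : ∀ x, gauge B x < 1 → ι x ∈ K := fun x hx =>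
    setOfPred_gauge_lt_one_subset_self hBc (by simpa [hB] using h0) hBa hx
  have hle : ∀ x, gauge B x ≤ 1 ↔ ι x ∈ K := fun x => by
    refine ⟨fun hx => ?_, fun hx => gauge_le_one_of_mem hx⟩
    have hcl' : IsClosed ((fun t : ℝ => t • ι x) ⁻¹' K) := hcl.preimage (by fun_prop)
    have hsub : Set.Ico (0 : ℝ) 1 ⊆ (fun t : ℝ => t • ι x) ⁻¹' K := fun t ht => by
      have := hlt (t • x) (by
        rw [gauge_smul_of_nonneg ht.1, smul_eq_mul]
        nlinarith [ht.1, ht.2, gauge_nonneg (s := B) x])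
      simpa using this
    have h1 := closure_minimal hsub hcl'
    rw [closure_Ico zero_ne_one] at h1
    simpa using h1 (Set.right_mem_Icc.2 zero_le_one)
  obtain ⟨C, hC⟩ := hbd.exists_norm_le
  have hzero : ∀ x, gauge B x = 0 → x = 0 := fun x hx => by
    have hall : ∀ n : ℕ, n * ‖ι x‖ ≤ C := fun n => by
      have := hC _ (hlt ((n : ℝ) • x) (by
        rw [gauge_smul_of_nonneg n.cast_nonneg, hx]; simp))
      simpa [norm_smul] using this
    by_contra hne
    have hpos : 0 < ‖ι x‖ := norm_pos_iff.2 ((map_ne_zero_iff ι hι).2 hne)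
    obtain ⟨n, hn⟩ := exists_nat_gt (C / ‖ι x‖)
    exact absurd (hall n) (not_le.2 ((div_lt_iff₀ hpos).1 hn))
  let _ : Norm S := ⟨gauge B⟩
  have core : NormedSpace.Core ℝ S :=
    { norm_nonneg := gauge_nonneg
      norm_smul := gauge_smul hBb
      norm_triangle := gauge_add_le hBc hBa
      norm_eq_zero_iff := fun x => ⟨hzero x, by rintro rfl; exact gauge_zero⟩ }
  let _ := NormedAddCommGroup.ofCore core
  exact ⟨S, inferInstance, NormedSpace.ofCore core, ι, hι, hK, hle⟩

section UnitBall

variable {F V : Type*} [NormedAddCommGroup F] [NormedSpace ℝ F] [NormedAddCommGroup V]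
  [NormedSpace ℝ V] {K : Set V}

theorem norm_le_iff_mem_smul {β : F →ₗ[ℝ] V} (hβ : ∀ x, ‖x‖ ≤ 1 ↔ β x ∈ K) {r : ℝ} (hr : 0 < r)
    (x : F) : ‖x‖ ≤ r ↔ β x ∈ r • K := by
  rw [Set.mem_smul_set_iff_inv_smul_mem₀ hr.ne', ← map_smul, ← hβ, norm_smul, norm_inv,
    Real.norm_of_nonneg hr.le, inv_mul_le_iff₀ hr, mul_one]

theorem continuous_of_isBounded_image_unitBall {β : F →ₗ[ℝ] V} (hβ : ∀ x, ‖x‖ ≤ 1 ↔ β x ∈ K)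
    (hbd : Bornology.IsBounded K) : Continuous β := by
  obtain ⟨C, hC⟩ := hbd.exists_norm_le
  refine (β.mkContinuous C fun x => ?_).continuous
  rcases eq_or_ne x 0 with rfl | hx
  · simp
  · obtain ⟨k, hk, hkx⟩ := (norm_le_iff_mem_smul hβ (norm_pos_iff.2 hx) x).1 le_rfl
    rw [← hkx, norm_smul, norm_norm, mul_comm]
    exact mul_le_mul_of_nonneg_right (hC k hk) (norm_nonneg x)

/-- A normed space whose closed unit ball is carried onto a compact set by a continuous injective
linear map is complete. -/
theorem completeSpace_of_isCompact_image_unitBall {β : F →L[ℝ] V} (hβ : ∀ x, ‖x‖ ≤ 1 ↔ β x ∈ K)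
    (hK : IsCompact K) (hrange : K ⊆ Set.range β) : CompleteSpace F := by
  refine Metric.complete_of_cauchySeq_tendsto fun u hu => ?_
  have hiff := fun {r : ℝ} (hr : 0 < r) x => norm_le_iff_mem_smul (β := (β : F →ₗ[ℝ] V)) hβ hr x
  obtain ⟨R, hR, huR⟩ := hu.isBounded_range.exists_pos_norm_le
  obtain ⟨y, hy, hlim⟩ := cauchySeq_tendsto_of_isComplete (hK.smul R).isComplete
    (fun n => (hiff hR (u n)).1 (huR _ ⟨n, rfl⟩)) (β.uniformContinuous.comp_cauchySeq hu)
  obtain ⟨k, hk, rfl⟩ := hy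
  obtain ⟨x, rfl⟩ := hrange hk
  refine ⟨R • x, Metric.tendsto_atTop.2 fun ε hε => ?_⟩
  obtain ⟨N, hN⟩ := Metric.cauchySeq_iff.1 hu (ε / 2) (half_pos hε)
  refine ⟨N, fun m hm => (?_ : dist (u m) (R • x) ≤ ε / 2).trans_lt (half_lt_self hε)⟩
  rw [dist_eq_norm, hiff (half_pos hε)]
  refine (hK.smul (ε / 2)).isClosed.mem_of_tendsto (b := Filter.atTop)
    (f := fun n => β (u m - u n)) ?_ ?_
  · simpa using hlim.const_sub (β (u m))
  · filter_upwards [Filter.eventually_ge_atTop N] with n hn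
    exact (hiff (half_pos hε) _).1 (dist_eq_norm (u m) (u n) ▸ (hN m hm n hn).le)

theorem isCompact_image_closedBall {β : F →L[ℝ] V} (hβ : ∀ x, ‖x‖ ≤ 1 ↔ β x ∈ K)
    (hK : IsCompact K) (hrange : K ⊆ Set.range β) (x : F) {r : ℝ} (hr : 0 < r) :
    IsCompact (β '' Metric.closedBall x r) := by
  have himg : β '' Metric.closedBall x r = (fun k => β x + r • k) '' K := by
    ext y
    constructor
    · rintro ⟨z, hz, rfl⟩
      obtain ⟨k, hk, hkz⟩ := (norm_le_iff_mem_smul (β := (β : F →ₗ[ℝ] V)) hβ hr (z - x)).1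
        (mem_closedBall_iff_norm.1 hz)
      exact ⟨k, hk, by simp_all⟩
    · rintro ⟨k, hk, rfl⟩
      obtain ⟨z, rfl⟩ := hrange hk
      refine ⟨x + r • z, ?_, by simp⟩
      rw [mem_closedBall_iff_norm, add_sub_cancel_left, norm_smul, Real.norm_of_nonneg hr.le]
      exact mul_le_of_le_one_right hr.le ((hβ z).2 hk)
  rw [himg]
  exact hK.image (by fun_prop)

end UnitBall

/-- An injective compact operator factors through a Banach space whose closed balls have compact
image in the codomain. -/
theorem IsCompactOperator.exists_factorization {E V : Type u} [NormedAddCommGroup E]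
    [NormedSpace ℝ E] [CompleteSpace E] [NormedAddCommGroup V] [NormedSpace ℝ V]
    {T : E →L[ℝ] V} (hT : IsCompactOperator T) (hinj : Function.Injective T) :
    ∃ (F : Type u) (_ : NormedAddCommGroup F) (_ : NormedSpace ℝ F) (_ : CompleteSpace F)
      (α : E →L[ℝ] F) (β : F →L[ℝ] V), Function.Injective α ∧ Function.Injective β ∧
      (∀ x, β (α x) = T x) ∧
      ∀ (x : F) (r : ℝ), 0 < r → IsCompact (β '' Metric.closedBall x r) := by
  have hAbs : AbsConvex ℝ (T '' Metric.closedBall 0 1) := by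
    refine ⟨fun a ha => ?_, (convex_closedBall 0 1).linear_image (T : E →ₗ[ℝ] V)⟩
    rintro _ ⟨_, ⟨x, hx, rfl⟩, rfl⟩
    exact ⟨a • x, balanced_closedBall_zero.smul_mem ha hx, map_smul T a x⟩
  set K := closure (T '' Metric.closedBall 0 1)
  have hK : IsCompact K := hT.isCompact_closure_image_closedBall 1
  have hmem : ∀ x, ‖x‖ ≤ 1 → T x ∈ K := fun x hx =>
    subset_closure ⟨x, mem_closedBall_zero_iff.2 hx, rfl⟩
  have h0 : (0 : V) ∈ K := by simpa using hmem 0 (by simp)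
  obtain ⟨F, _, _, β', hβinj, hrange, hβ⟩ := exists_normedSpace_closedBall_eq hAbs.closure.1
    hAbs.closure.2 h0 isClosed_closure hK.isBounded
  let β : F →L[ℝ] V := ⟨β', continuous_of_isBounded_image_unitBall hβ hK.isBounded⟩
  have : CompleteSpace F := completeSpace_of_isCompact_image_unitBall (β := β) hβ hK hrange
  have hTrange : ∀ x, T x ∈ LinearMap.range β' := fun x => by
    obtain ⟨y, hy⟩ := hrange (hmem ((‖x‖ + 1)⁻¹ • x) (by
      rw [norm_smul, norm_inv, Real.norm_of_nonneg (by positivity)]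
      exact (inv_mul_le_iff₀ (by positivity)).2 (by linarith)))
    refine ⟨(‖x‖ + 1) • y, ?_⟩
    rw [map_smul, hy, map_smul, smul_inv_smul₀ (by positivity)]
  let α' : E →ₗ[ℝ] F := (LinearEquiv.ofInjective β' hβinj).symm.toLinearMap ∘ₗ
    (T : E →ₗ[ℝ] V).codRestrict (LinearMap.range β') hTrange
  have hfac : ∀ x, β (α' x) = T x := fun x =>
    congrArg Subtype.val ((LinearEquiv.ofInjective β' hβinj).apply_symm_apply ⟨T x, hTrange x⟩)
  have hgraph : (α'.graph : Set (E × F)) = {p | β p.2 = T p.1} := by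
    ext p
    simp only [SetLike.mem_coe, LinearMap.mem_graph_iff, Set.mem_ofPred_eq, ← hfac]
    exact hβinj.eq_iff.symm
  have hα : Continuous α' := α'.continuous_of_isClosed_graph (by
    rw [hgraph]
    exact isClosed_eq (by fun_prop) (by fun_prop))
  refine ⟨F, _, _, this, ⟨α', hα⟩, β, fun x y hxy => hinj ?_, hβinj, hfac,
    fun x r hr => isCompact_image_closedBall hβ hK hrange x hr⟩
  rw [← hfac, ← hfac]
  exact congrArg β hxy

/-- **Lemma 3.1.** For any sequence of real Banach spaces `E n` with injective compact
continuous linear maps `i n : E n → E (n+1)`, there exist interpolating Banach spaces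
`F n` with `E n → F n → E (n+1)` such that the connecting maps `F n → F (n+1)` take
closed balls to compact sets. -/
theorem exists_silvaInterpolation (E : ℕ → Type u) [∀ n, NormedAddCommGroup (E n)]
    [∀ n, NormedSpace ℝ (E n)] [∀ n, CompleteSpace (E n)]
    (i : ∀ n, E n →L[ℝ] E (n + 1))
    (hinj : ∀ n, Function.Injective (i n))
    (hcpt : ∀ n, IsCompactOperator (i n)) :
    Nonempty (SilvaInterpolation E i) := by
  choose F instNorm instSpace instComplete α β hα hβ hfac hball using
    fun n => (hcpt n).exists_factorization (hinj n)
  refine ⟨{ F, α, β, α_inj := hα, β_inj := hβ, factor := hfac, ball_compact := fun n x r hr => ?_ }⟩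
  rw [← Set.image_image (α (n + 1)) (β n)]
  exact (hball n x r hr).image (α (n + 1)).continuous
end

section
/- Let (E_n)_{n∈ℕ} be a sequence of real Banach spaces, each equipped with a real Lie algebra structure whose Lie bracket E_n × E_n → E_n is a continuous bilinear map (i.e., each E_n is a Banach-Lie algebra), together with injective continuous linear maps i_n : E_n → E_{n+1} which are Lie algebra homomorphisms and compact operators. Then there exist real Banach spaces F_n, each equipped with a real Lie algebra structure whose Lie bracket is continuous bilinear, together with injective continuous linear Lie algebra homomorphisms α_n : E_n → F_n and β_n : F_n → E_{n+1} satisfying β_n ∘ α_n = i_n for each n, and such that for each n the composite map α_{n+1} ∘ β_n : F_n → F_{n+1} sends every closed ball of F_n to a compact subset of F_{n+1}. -/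
open Topology

universe u

/-- The data interpolating a compact direct sequence of Banach–Lie algebras, as in
Lemma 3.2: Banach spaces `F n` carrying continuous bilinear Lie brackets `bF n`
(alternating and satisfying the Jacobi identity), with injective continuous linear Lie
algebra homomorphisms `α n : E n → F n` and `β n : F n → E (n+1)` factoring the inclusion
`i n : E n → E (n+1)`, such that each composite `α (n+1) ∘ β n : F n → F (n+1)` maps
closed balls of `F n` to compact subsets of `F (n+1)`. -/
structure LieSilvaInterpolation (E : ℕ → Type u) [∀ n, NormedAddCommGroup (E n)]
    [∀ n, NormedSpace ℝ (E n)]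
    (bE : ∀ n, E n →L[ℝ] E n →L[ℝ] E n)
    (i : ∀ n, E n →L[ℝ] E (n + 1)) where
  F : ℕ → Type u
  [instNorm : ∀ n, NormedAddCommGroup (F n)]
  [instSpace : ∀ n, NormedSpace ℝ (F n)]
  [instComplete : ∀ n, CompleteSpace (F n)]
  bF : ∀ n, F n →L[ℝ] F n →L[ℝ] F n
  bF_alternating : ∀ n (x : F n), bF n x x = 0
  bF_jacobi : ∀ n (x y z : F n),
    bF n x (bF n y z) + bF n y (bF n z x) + bF n z (bF n x y) = 0
  α : ∀ n, E n →L[ℝ] F n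
  β : ∀ n, F n →L[ℝ] E (n + 1)
  α_inj : ∀ n, Function.Injective (α n)
  β_inj : ∀ n, Function.Injective (β n)
  α_bracket : ∀ n (x y : E n), α n (bE n x y) = bF n (α n x) (α n y)
  β_bracket : ∀ n (x y : F n), β n (bF n x y) = bE (n + 1) (β n x) (β n y)
  factor : ∀ n (x : E n), β n (α n x) = i n x
  ball_compact : ∀ n (x : F n) (r : ℝ), 0 < r →
    IsCompact ((fun y => α (n + 1) (β n y)) '' Metric.closedBall x r)

open Set Metric Filter in
/-- The subspace spanned by a bounded closed disk `K` is a Banach space with closed unit ball `K`,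
where the disk is presented as the closed unit ball of a seminorm on a vector space. -/
theorem exists_banachSpace_of_seminorm {P : Type u} [AddCommGroup P] [Module ℝ P]
    {G : Type*} [NormedAddCommGroup G] [NormedSpace ℝ G] [CompleteSpace G]
    (p : Seminorm ℝ P) (f : P →ₗ[ℝ] G) (hf : Function.Injective f) {K : Set G}
    (hK : IsClosed K) (hKb : Bornology.IsBounded K) (hpK : f '' p.closedBall 0 1 = K) :
    ∃ (F : Type u) (_ : NormedAddCommGroup F) (_ : NormedSpace ℝ F) (_ : CompleteSpace F)
      (j : F →L[ℝ] G), Function.Injective j ∧ j '' closedBall 0 1 = K := by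
  obtain ⟨M, hM⟩ := hKb.exists_norm_le
  have mem_K {x : P} : f x ∈ K ↔ p x ≤ 1 := by
    rw [← hpK, hf.mem_set_image, Seminorm.mem_closedBall_zero]
  have mem_smul {r : ℝ} (hr : 0 < r) {x : P} : r⁻¹ • f x ∈ K ↔ p x ≤ r := by
    rw [← map_smul, mem_K, map_smul_eq_mul, Real.norm_of_nonneg (inv_nonneg.2 hr.le),
      inv_mul_le_iff₀ hr, mul_one]
  have norm_le_of_le {r : ℝ} (hr : 0 < r) {x : P} (hx : p x ≤ r) : ‖f x‖ ≤ M * r := by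
    have := hM _ ((mem_smul hr).2 hx)
    rwa [norm_smul, norm_inv, Real.norm_of_nonneg hr.le, inv_mul_le_iff₀ hr, mul_comm] at this
  have norm_le (x : P) : ‖f x‖ ≤ M * p x := by
    have h : Tendsto (fun r ↦ M * r) (𝓝[>] (p x)) (𝓝 (M * p x)) :=
      ((continuous_const_mul M).tendsto _).mono_left inf_le_left
    refine ge_of_tendsto h ?_
    filter_upwards [self_mem_nhdsWithin] with r hr
    exact norm_le_of_le ((apply_nonneg p x).trans_lt hr) (le_of_lt hr)
  let : Norm P := ⟨p⟩
  have core : NormedSpace.Core ℝ P :=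
    { norm_nonneg := apply_nonneg p
      norm_smul := map_smul_eq_mul p
      norm_triangle := map_add_le_add p
      norm_eq_zero_iff := fun x ↦ by
        refine ⟨fun (h : p x = 0) ↦ hf ?_, fun h ↦ h ▸ map_zero p⟩
        rw [map_zero, ← norm_le_zero_iff]
        simpa [h] using norm_le x }
  let : NormedAddCommGroup P := .ofCore core
  let : NormedSpace ℝ P := .ofCore core
  let j : P →L[ℝ] G := f.mkContinuous M norm_le
  refine ⟨P, inferInstance, inferInstance, ?_, j, hf, ?_⟩
  · refine complete_of_cauchySeq_tendsto fun u hu ↦ ?_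
    obtain ⟨y, hy⟩ := cauchySeq_tendsto_of_complete (j.uniformContinuous.comp_cauchySeq hu)
    replace hy : Tendsto (fun n ↦ f (u n)) atTop (𝓝 y) := hy
    obtain ⟨R, hR, hbd⟩ := cauchySeq_bdd hu
    have hyK : R⁻¹ • (y - f (u 0)) ∈ K := by
      refine hK.mem_of_tendsto ((hy.sub_const _).const_smul _) (.of_forall fun n ↦ ?_)
      rw [← map_sub, mem_smul hR]
      exact (dist_eq_norm (u n) (u 0) ▸ hbd n 0).le
    obtain ⟨x, hx⟩ : ∃ x, f x = y := by
      obtain ⟨z, -, hz⟩ := hpK ▸ hyK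
      refine ⟨R • z + u 0, ?_⟩
      rw [map_add, map_smul, hz, smul_inv_smul₀ hR.ne', sub_add_cancel]
    refine ⟨x, Metric.tendsto_atTop'.2 fun ε hε ↦ ?_⟩
    obtain ⟨N, hN⟩ := Metric.cauchySeq_iff.1 hu (ε / 2) (half_pos hε)
    refine ⟨N, fun n hn ↦ lt_of_le_of_lt ?_ (half_lt_self hε)⟩
    rw [dist_eq_norm]
    refine (mem_smul (half_pos hε)).1 ?_
    rw [map_sub, hx]
    refine hK.mem_of_tendsto ((hy.const_sub _).const_smul _) ?_
    filter_upwards [eventually_ge_atTop N] with m hm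
    rw [← map_sub, mem_smul (half_pos hε)]
    exact (dist_eq_norm (u n) (u m) ▸ hN n hn.le m hm).le
  · rw [← hpK]
    congr 1
    ext x
    rw [mem_closedBall_zero_iff, Seminorm.mem_closedBall_zero]
    rfl

open Pointwise in
/-- A bounded closed disk in a Banach space is the injective image of the closed unit ball of a
Banach space. -/
theorem exists_banachSpace_of_disk {G : Type u} [NormedAddCommGroup G] [NormedSpace ℝ G]
    [CompleteSpace G] {K : Set G} (hK : IsClosed K) (hKb : Bornology.IsBounded K)
    (hconv : Convex ℝ K) (hbal : Balanced ℝ K) (hne : K.Nonempty) :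
    ∃ (F : Type u) (_ : NormedAddCommGroup F) (_ : NormedSpace ℝ F) (_ : CompleteSpace F)
      (j : F →L[ℝ] G), Function.Injective j ∧ j '' Metric.closedBall 0 1 = K := by
  let S := Submodule.span ℝ K
  let K' : Set S := S.subtype ⁻¹' K
  have hbal' : Balanced ℝ K' := hbal.mulActionHom_preimage S.subtype.toMulActionHom
  have hconv' : Convex ℝ K' := hconv.linear_preimage S.subtype
  have exists_smul (x : G) (hx : x ∈ S) : ∃ r : ℝ, 0 ≤ r ∧ x ∈ r • K := by
    induction hx using Submodule.span_induction with
    | mem x hx => exact ⟨1, zero_le_one, by rwa [one_smul]⟩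
    | zero => exact ⟨1, zero_le_one, by rw [one_smul]; exact hbal.zero_mem hne⟩
    | add x y _ _ hx hy =>
      obtain ⟨r, hr, hx⟩ := hx
      obtain ⟨s, hs, hy⟩ := hy
      exact ⟨r + s, add_nonneg hr hs, hconv.add_smul hr hs ▸ Set.add_mem_add hx hy⟩
    | smul c x _ hx =>
      obtain ⟨r, hr, k, hk, rfl⟩ := hx
      refine ⟨‖c * r‖, norm_nonneg _, ?_⟩
      refine hbal.smul_mono (norm_norm (c * r)).ge ?_
      exact ⟨k, hk, mul_smul c r k⟩
  have habs : Absorbent ℝ K' := fun x ↦ by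
    obtain ⟨r, hr, k, hk, hx⟩ := exists_smul x x.2
    refine absorbs_iff_norm.2 ⟨r, fun c hc ↦ Set.singleton_subset_iff.2 ?_⟩
    have hkS : k ∈ S := Submodule.subset_span hk
    refine hbal'.smul_mono ((Real.norm_of_nonneg hr).trans_le hc) ?_
    exact ⟨⟨k, hkS⟩, hk, Subtype.ext hx⟩
  have hK' : IsClosed K' := hK.preimage continuous_subtype_val
  refine exists_banachSpace_of_seminorm (gaugeSeminorm hbal' hconv' habs) S.subtype
    S.subtype_injective hK hKb ?_
  have hball : (gaugeSeminorm hbal' hconv' habs).closedBall 0 1 = K' := by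
    ext x
    rw [Seminorm.mem_closedBall_zero]
    refine ⟨fun h ↦ hK'.closure_eq ▸ mem_closure_of_gauge_le_one hconv' ?_ habs h,
      gauge_le_one_of_mem⟩
    exact hbal.zero_mem hne
  rw [hball, Set.image_preimage_eq_iff]
  exact fun k hk ↦ ⟨⟨k, Submodule.subset_span hk⟩, rfl⟩

/-- Every vector is its norm times a vector of the closed unit ball. -/
theorem exists_norm_smul_eq {V : Type*} [NormedAddCommGroup V] [NormedSpace ℝ V] (x : V) :
    ∃ u ∈ Metric.closedBall (0 : V) 1, ‖x‖ • u = x := by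
  refine ⟨‖x‖⁻¹ • x, ?_, ?_⟩
  · rw [mem_closedBall_zero_iff, norm_smul, norm_inv, norm_norm]
    exact inv_mul_le_one
  · rcases eq_or_ne x 0 with rfl | hx
    · simp
    · exact smul_inv_smul₀ (norm_ne_zero_iff.2 hx) x

/-- An injective compact homomorphism between Banach–Lie algebras factors through a Banach–Lie
algebra whose closed balls are compact in the target. -/
theorem exists_banachLie_factorization {E : Type*} {G : Type u}
    [NormedAddCommGroup E] [NormedSpace ℝ E]
    [NormedAddCommGroup G] [NormedSpace ℝ G] [CompleteSpace G]
    (bE : E →L[ℝ] E →L[ℝ] E) (bG : G →L[ℝ] G →L[ℝ] G)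
    (hGalt : ∀ x, bG x x = 0)
    (hGjacobi : ∀ x y z, bG x (bG y z) + bG y (bG z x) + bG z (bG x y) = 0)
    (i : E →L[ℝ] G) (hinj : Function.Injective i)
    (hhom : ∀ x y, i (bE x y) = bG (i x) (i y)) (hcpt : IsCompactOperator i) :
    ∃ (F : Type u) (_ : NormedAddCommGroup F) (_ : NormedSpace ℝ F) (_ : CompleteSpace F)
      (bF : F →L[ℝ] F →L[ℝ] F) (α : E →L[ℝ] F) (β : F →L[ℝ] G),
      (∀ x, bF x x = 0) ∧
      (∀ x y z, bF x (bF y z) + bF y (bF z x) + bF z (bF x y) = 0) ∧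
      Function.Injective α ∧ Function.Injective β ∧
      (∀ x y, α (bE x y) = bF (α x) (α y)) ∧
      (∀ x y, β (bF x y) = bG (β x) (β y)) ∧
      (∀ x, β (α x) = i x) ∧
      ∀ x r, IsCompact (β '' Metric.closedBall x r) := by
  let K : Set G := closure (i '' Metric.closedBall 0 1)
  have hK : IsCompact K := hcpt.isCompact_closure_image_closedBall (f := (i : E →ₗ[ℝ] G)) 1
  have hconv : Convex ℝ K :=
    ((convex_closedBall (0 : E) 1).linear_image (i : E →ₗ[ℝ] G)).closure
  have hbal : Balanced ℝ K := by
    refine Balanced.closure fun c hc ↦ ?_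
    rintro _ ⟨_, ⟨x, hx, rfl⟩, rfl⟩
    exact ⟨c • x, balanced_closedBall_zero.smul_mem hc hx, map_smul i c x⟩
  have hne : K.Nonempty :=
    ((Metric.nonempty_closedBall.2 zero_le_one).image i).closure
  obtain ⟨F, _, _, _, j, hj, hjK⟩ :=
    exists_banachSpace_of_disk hK.isClosed hK.isBounded hconv hbal hne
  have norm_le_one_of_mem {z : F} (hz : j z ∈ K) : ‖z‖ ≤ 1 := by
    rwa [← hjK, hj.mem_set_image, mem_closedBall_zero_iff] at hz
  have exists_lift (x : E) : ∃ z, j z = i x ∧ ‖z‖ ≤ 1 * ‖x‖ := by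
    obtain ⟨u, hu, hx⟩ := exists_norm_smul_eq x
    have huK : i u ∈ K := subset_closure (Set.mem_image_of_mem i hu)
    obtain ⟨z, hz, hzu⟩ := hjK ▸ huK
    refine ⟨‖x‖ • z, by rw [map_smul, hzu, ← map_smul, hx], ?_⟩
    rw [norm_smul, norm_norm, mul_comm]
    exact mul_le_mul_of_nonneg_right (mem_closedBall_zero_iff.1 hz) (norm_nonneg x)
  let C : ℝ := ‖bE‖ + 1
  have hC : 0 < C := by positivity
  have bracket_mem {a b : G} (ha : a ∈ K) (hb : b ∈ K) : C⁻¹ • bG a b ∈ K := by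
    refine map_mem_closure₂ (f := fun a b ↦ C⁻¹ • bG a b) (by fun_prop) ha hb ?_
    rintro _ ⟨x, hx, rfl⟩ _ ⟨y, hy, rfl⟩
    refine ⟨C⁻¹ • bE x y, ?_, by rw [map_smul, hhom]⟩
    rw [mem_closedBall_zero_iff] at hx hy ⊢
    rw [norm_smul, norm_inv, Real.norm_of_nonneg hC.le, inv_mul_le_iff₀ hC, mul_one]
    calc ‖bE x y‖ ≤ ‖bE‖ * ‖x‖ * ‖y‖ := bE.le_opNorm₂ x y
      _ ≤ ‖bE‖ * 1 * 1 := by gcongr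
      _ ≤ C := by simp [C]
  have exists_bracket (x y : F) : ∃ z, j z = bG (j x) (j y) ∧ ‖z‖ ≤ C * ‖x‖ * ‖y‖ := by
    obtain ⟨u, hu, hx⟩ := exists_norm_smul_eq x
    obtain ⟨v, hv, hy⟩ := exists_norm_smul_eq y
    obtain ⟨z, hz, hzuv⟩ := hjK ▸ bracket_mem
      (hjK ▸ Set.mem_image_of_mem j hu) (hjK ▸ Set.mem_image_of_mem j hv)
    refine ⟨(C * ‖x‖ * ‖y‖) • z, ?_, ?_⟩
    · conv_rhs => rw [← hx, ← hy]
      simp only [map_smul, hzuv, smul_apply, smul_smul]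
      congr 1
      field_simp
    · rw [norm_smul, Real.norm_of_nonneg (by positivity)]
      exact mul_le_of_le_one_right (by positivity) (mem_closedBall_zero_iff.1 hz)
  choose a ha ha_le using exists_lift
  choose b hb hb_le using exists_bracket
  let α : E →L[ℝ] F := LinearMap.mkContinuous
    { toFun := a
      map_add' := fun x y ↦ hj (by simp [ha])
      map_smul' := fun c x ↦ hj (by simp [ha]) } 1 ha_le
  let bF : F →L[ℝ] F →L[ℝ] F := LinearMap.mkContinuous₂
    (LinearMap.mk₂ ℝ b (fun x y z ↦ hj (by simp [hb])) (fun c x y ↦ hj (by simp [hb]))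
      (fun x y z ↦ hj (by simp [hb])) (fun c x y ↦ hj (by simp [hb]))) C hb_le
  have hα (x : E) : j (α x) = i x := ha x
  have hbF (x y : F) : j (bF x y) = bG (j x) (j y) := hb x y
  refine ⟨F, inferInstance, inferInstance, inferInstance, bF, α, j, fun x ↦ hj ?_,
    fun x y z ↦ hj ?_, fun x y h ↦ hinj ?_, hj, fun x y ↦ hj ?_, hbF, hα, fun x r ↦ ?_⟩
  · rw [hbF, hGalt, map_zero]
  · simp only [map_add, hbF, hGjacobi, map_zero]
  · rw [← hα, h, hα]
  · rw [hα, hbF, hα, hα, hhom]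
  · rcases lt_or_ge r 0 with hr | hr
    · simp [Metric.closedBall_eq_empty.2 hr]
    · have : j '' Metric.closedBall x r = (fun k ↦ j x + r • k) '' K := by
        rw [← hjK, Set.image_image, ← affinity_unitClosedBall hr x, ← Set.image_smul,
          ← Set.image_vadd, Set.image_image, Set.image_image]
        simp
      rw [this]
      exact hK.image (by fun_prop)

/-- **Lemma 3.2.** For any sequence of real Banach–Lie algebras `E n` (Banach spaces with
continuous bilinear, alternating brackets `bE n` satisfying the Jacobi identity) with
injective compact continuous linear Lie algebra homomorphisms `i n : E n → E (n+1)`,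
there exist interpolating Banach–Lie algebras `F n` with `E n → F n → E (n+1)` such that
the connecting maps `F n → F (n+1)` take closed balls to compact sets. -/
theorem exists_lieSilvaInterpolation (E : ℕ → Type u) [∀ n, NormedAddCommGroup (E n)]
    [∀ n, NormedSpace ℝ (E n)] [∀ n, CompleteSpace (E n)]
    (bE : ∀ n, E n →L[ℝ] E n →L[ℝ] E n)
    (hbEalt : ∀ n (x : E n), bE n x x = 0)
    (hbEjacobi : ∀ n (x y z : E n),
      bE n x (bE n y z) + bE n y (bE n z x) + bE n z (bE n x y) = 0)
    (i : ∀ n, E n →L[ℝ] E (n + 1))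
    (hinj : ∀ n, Function.Injective (i n))
    (hhom : ∀ n (x y : E n), i n (bE n x y) = bE (n + 1) (i n x) (i n y))
    (hcpt : ∀ n, IsCompactOperator (i n)) :
    Nonempty (LieSilvaInterpolation E bE i) := by
  choose F instNorm instSpace instComplete bF α β halt hjac hα hβ hαb hβb hfac hball using
    fun n ↦ exists_banachLie_factorization (bE n) (bE (n + 1)) (hbEalt (n + 1))
      (hbEjacobi (n + 1)) (i n) (hinj n) (hhom n) (hcpt n)
  exact ⟨{
    F := F
    bF := bF
    bF_alternating := halt
    bF_jacobi := hjac
    α := α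
    β := β
    α_inj := hα
    β_inj := hβ
    α_bracket := hαb
    β_bracket := hβb
    factor := hfac
    ball_compact := fun n x r _ ↦ by
      rw [← Set.image_image (α (n + 1)) (β n)]
      exact (hball n x r).image (α (n + 1)).continuous }⟩
end
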